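/- arXiv:1904.04628 — 2 statements merged into one kernel-verified Lean document; each statement's English description precedes it below -/
import Mathlib

section
/- Let r be a tournament on Fin 4 with no directed 3-cycle, and let v0, v1, v2, v3 be the unique enumeration of Fin 4 with r v_i v_j if and only if i < j. Then the mixed edges of the tetrahedron are exactly {v0, v2} and {v1, v3}; in particular, every acyclically oriented tetrahedron has exactly two mixed edges. -/
/-- `e` is the long edge of the face `F` (joining the source of `F`
to the sink of `F`) for the edge orientation `r`. -/
def IsLongEdge (r : Fin 4 → Fin 4 → Prop) (F e : Finset (Fin 4)) : Prop :=
  ∃ s m t : Fin 4, F = {s, m, t} ∧ r s m ∧ r m t ∧ r s t ∧ e = {s, t}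

/-- `e` is the bottom short edge of the face `F` (joining the source of `F`
to the middle vertex of `F`) for the edge orientation `r`. -/
def IsBottomEdge (r : Fin 4 → Fin 4 → Prop) (F e : Finset (Fin 4)) : Prop :=
  ∃ s m t : Fin 4, F = {s, m, t} ∧ r s m ∧ r m t ∧ r s t ∧ e = {s, m}

/-- `e` is the top short edge of the face `F` (joining the middle vertex of
`F` to the sink of `F`) for the edge orientation `r`. -/
def IsTopEdge (r : Fin 4 → Fin 4 → Prop) (F e : Finset (Fin 4)) : Prop :=
  ∃ s m t : Fin 4, F = {s, m, t} ∧ r s m ∧ r m t ∧ r s t ∧ e = {m, t}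

/-- `e` is the very long edge of the tetrahedron: an edge that is the long
edge of both (i.e. every) faces of the tetrahedron containing it. -/
def IsVeryLongEdge (r : Fin 4 → Fin 4 → Prop) (e : Finset (Fin 4)) : Prop :=
  e.card = 2 ∧ ∀ F : Finset (Fin 4), F.card = 3 → e ⊆ F → IsLongEdge r F e

/-- `e` is a mixed edge of the tetrahedron: an edge that is the long edge of
exactly one of the two faces containing it. -/
def IsMixedEdge (r : Fin 4 → Fin 4 → Prop) (e : Finset (Fin 4)) : Prop :=
  e.card = 2 ∧ ∃! F : Finset (Fin 4), F.card = 3 ∧ e ⊆ F ∧ IsLongEdge r F e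

/-- `e` is a compatibly short edge of the tetrahedron: an edge that is the
bottom short edge of both faces containing it, or the top short edge of both
faces containing it. -/
def IsCompatiblyShortEdge (r : Fin 4 → Fin 4 → Prop) (e : Finset (Fin 4)) : Prop :=
  e.card = 2 ∧
    ((∀ F : Finset (Fin 4), F.card = 3 → e ⊆ F → IsBottomEdge r F e) ∨
     (∀ F : Finset (Fin 4), F.card = 3 → e ⊆ F → IsTopEdge r F e))

theorem isLongEdge_map_iff {r q : Fin 4 → Fin 4 → Prop} (σ : Equiv.Perm (Fin 4))
    (h : ∀ i j, r (σ i) (σ j) ↔ q i j) (F e : Finset (Fin 4)) :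
    IsLongEdge r (F.map σ.toEmbedding) (e.map σ.toEmbedding) ↔ IsLongEdge q F e := by
  have pair (a b : Fin 4) : ({σ a, σ b} : Finset (Fin 4)) =
      Finset.map σ.toEmbedding {a, b} := by simp
  have triple (a b c : Fin 4) : ({σ a, σ b, σ c} : Finset (Fin 4)) =
      Finset.map σ.toEmbedding {a, b, c} := by simp
  refine (σ.exists_congr fun s => σ.exists_congr fun m => σ.exists_congr fun t => ?_).symm
  rw [triple, pair, h, h, h, Finset.map_inj, Finset.map_inj]

theorem isMixedEdge_map_iff {r q : Fin 4 → Fin 4 → Prop} (σ : Equiv.Perm (Fin 4))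
    (h : ∀ i j, r (σ i) (σ j) ↔ q i j) (e : Finset (Fin 4)) :
    IsMixedEdge r (e.map σ.toEmbedding) ↔ IsMixedEdge q e := by
  unfold IsMixedEdge
  rw [← σ.finsetCongr.existsUnique_congr_right]
  simp only [Equiv.finsetCongr_apply, Finset.card_map, Finset.map_subset_map,
    isLongEdge_map_iff σ h]

theorem isMixedEdge_lt_iff (e : Finset (Fin 4)) :
    IsMixedEdge (· < ·) e ↔ e = {0, 2} ∨ e = {1, 3} := by
  revert e
  unfold IsMixedEdge IsLongEdge ExistsUnique
  decide

/-- For an acyclic edge orientation of the tetrahedron, enumerated by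
`v 0, v 1, v 2, v 3` with `r (v i) (v j) ↔ i < j`, the mixed edges are
exactly `{v 0, v 2}` and `{v 1, v 3}`; in particular there are exactly two
of them. -/
theorem mixed_edges_eq (r : Fin 4 → Fin 4 → Prop)
    (hasym : ∀ a b, ¬(r a b ∧ r b a))
    (htotal : ∀ a b, a ≠ b → r a b ∨ r b a)
    (hacyclic : ¬ ∃ a b c, r a b ∧ r b c ∧ r c a)
    (v : Fin 4 → Fin 4) (hv : ∀ i j : Fin 4, r (v i) (v j) ↔ i < j) :
    (∀ e : Finset (Fin 4),
      IsMixedEdge r e ↔ (e = {v 0, v 2} ∨ e = {v 1, v 3})) ∧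
    ({v 0, v 2} : Finset (Fin 4)) ≠ {v 1, v 3} := by
  have hinj : Function.Injective v := fun i j hij => by
    have hr (k : Fin 4) : ¬ r (v k) (v k) := fun h => hasym _ _ ⟨h, h⟩
    exact le_antisymm (not_lt.mp fun h => hr j (hij ▸ (hv j i).mpr h))
      (not_lt.mp fun h => hr j (hij ▸ (hv i j).mpr h))
  let σ : Equiv.Perm (Fin 4) := Equiv.ofBijective v (Finite.injective_iff_bijective.mp hinj)
  have h02 : ({v 0, v 2} : Finset (Fin 4)) = Finset.map σ.toEmbedding {0, 2} := by
    simp [σ]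
  have h13 : ({v 1, v 3} : Finset (Fin 4)) = Finset.map σ.toEmbedding {1, 3} := by
    simp [σ]
  rw [h02, h13]
  refine ⟨fun e => ?_, fun h => absurd (Finset.map_injective _ h) (by decide)⟩
  obtain ⟨e, rfl⟩ := σ.finsetCongr.surjective e
  rw [Equiv.finsetCongr_apply, isMixedEdge_map_iff σ hv, isMixedEdge_lt_iff,
    Finset.map_inj, Finset.map_inj]
end

section
/- Let r be a tournament on Fin 4 with no directed 3-cycle, and let v0, v1, v2, v3 be the unique enumeration of Fin 4 with r v_i v_j if and only if i < j. Then: the edge {v0, v1} is the bottom short edge of both faces containing it; the edge {v2, v3} is the top short edge of both faces containing it; the edge {v1, v2} is the bottom short edge of one of its two faces and the top short edge of the other; and the compatibly short edges of the tetrahedron are exactly {v0, v1} and {v2, v3}. -/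
instance (r : Fin 4 → Fin 4 → Prop) [DecidableRel r] (F e : Finset (Fin 4)) :
    Decidable (IsBottomEdge r F e) := by
  unfold IsBottomEdge
  infer_instance

instance (r : Fin 4 → Fin 4 → Prop) [DecidableRel r] (F e : Finset (Fin 4)) :
    Decidable (IsTopEdge r F e) := by
  unfold IsTopEdge
  infer_instance

instance (r : Fin 4 → Fin 4 → Prop) [DecidableRel r] (e : Finset (Fin 4)) :
    Decidable (IsCompatiblyShortEdge r e) := by
  unfold IsCompatiblyShortEdge
  infer_instance

theorem exists_triple_iff {α β : Type*} {v : α → β} (hv : Function.Surjective v)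
    {p : β → β → β → Prop} : (∃ a b c, p a b c) ↔ ∃ a b c, p (v a) (v b) (v c) :=
  hv.exists.trans <| exists_congr fun _ => hv.exists.trans <| exists_congr fun _ => hv.exists

theorem isBottomEdge_map_iff {r s : Fin 4 → Fin 4 → Prop} (v : Fin 4 ≃ Fin 4)
    (hv : ∀ i j, r (v i) (v j) ↔ s i j) (F e : Finset (Fin 4)) :
    IsBottomEdge r (F.map v.toEmbedding) (e.map v.toEmbedding) ↔ IsBottomEdge s F e := by
  unfold IsBottomEdge
  rw [exists_triple_iff v.surjective]
  simp only [hv, ← Finset.map_inj (f := v.toEmbedding) (s₁ := F),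
    ← Finset.map_inj (f := v.toEmbedding) (s₁ := e),
    Finset.map_insert, Finset.map_singleton, Equiv.coe_toEmbedding]

theorem isTopEdge_map_iff {r s : Fin 4 → Fin 4 → Prop} (v : Fin 4 ≃ Fin 4)
    (hv : ∀ i j, r (v i) (v j) ↔ s i j) (F e : Finset (Fin 4)) :
    IsTopEdge r (F.map v.toEmbedding) (e.map v.toEmbedding) ↔ IsTopEdge s F e := by
  unfold IsTopEdge
  rw [exists_triple_iff v.surjective]
  simp only [hv, ← Finset.map_inj (f := v.toEmbedding) (s₁ := F),
    ← Finset.map_inj (f := v.toEmbedding) (s₁ := e),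
    Finset.map_insert, Finset.map_singleton, Equiv.coe_toEmbedding]

theorem forall_face_map_iff (v : Fin 4 ≃ Fin 4) (e : Finset (Fin 4))
    {p : Finset (Fin 4) → Prop} :
    (∀ F : Finset (Fin 4), F.card = 3 → e.map v.toEmbedding ⊆ F → p F) ↔
      ∀ F : Finset (Fin 4), F.card = 3 → e ⊆ F → p (F.map v.toEmbedding) := by
  rw [v.finsetCongr.surjective.forall]
  simp only [Equiv.finsetCongr_apply, Finset.card_map, Finset.map_subset_map]

theorem isCompatiblyShortEdge_map_iff {r s : Fin 4 → Fin 4 → Prop} (v : Fin 4 ≃ Fin 4)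
    (hv : ∀ i j, r (v i) (v j) ↔ s i j) (e : Finset (Fin 4)) :
    IsCompatiblyShortEdge r (e.map v.toEmbedding) ↔ IsCompatiblyShortEdge s e := by
  unfold IsCompatiblyShortEdge
  rw [forall_face_map_iff, forall_face_map_iff]
  simp only [Finset.card_map, isBottomEdge_map_iff v hv, isTopEdge_map_iff v hv]

theorem isBottomEdge_lt_zero_one (F : Finset (Fin 4)) (hF : F.card = 3) (h : {0, 1} ⊆ F) :
    IsBottomEdge (· < ·) F {0, 1} := by
  decide +revert

theorem isTopEdge_lt_two_three (F : Finset (Fin 4)) (hF : F.card = 3) (h : {2, 3} ⊆ F) :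
    IsTopEdge (· < ·) F {2, 3} := by
  decide +revert

theorem eq_or_eq_of_one_two_subset (F : Finset (Fin 4)) (hF : F.card = 3) (h : {1, 2} ⊆ F) :
    F = {1, 2, 3} ∨ F = {0, 1, 2} := by
  decide +revert

theorem isCompatiblyShortEdge_lt_iff (e : Finset (Fin 4)) :
    IsCompatiblyShortEdge (· < ·) e ↔ e = {0, 1} ∨ e = {2, 3} := by
  decide +revert

/-- For an acyclic edge orientation of the tetrahedron, enumerated by
`v 0, v 1, v 2, v 3` with `r (v i) (v j) ↔ i < j`: the edge `{v 0, v 1}` is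
the bottom short edge of both of its faces, the edge `{v 2, v 3}` is the top
short edge of both of its faces, the edge `{v 1, v 2}` is the bottom short
edge of one of its two faces and the top short edge of the other, and the
compatibly short edges are exactly `{v 0, v 1}` and `{v 2, v 3}`. -/
theorem compatibly_short_edges (r : Fin 4 → Fin 4 → Prop)
    (hasym : ∀ a b, ¬(r a b ∧ r b a))
    (htotal : ∀ a b, a ≠ b → r a b ∨ r b a)
    (hacyclic : ¬ ∃ a b c, r a b ∧ r b c ∧ r c a)
    (v : Fin 4 → Fin 4) (hv : ∀ i j : Fin 4, r (v i) (v j) ↔ i < j) :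
    (∀ F : Finset (Fin 4), F.card = 3 → ({v 0, v 1} : Finset (Fin 4)) ⊆ F →
        IsBottomEdge r F {v 0, v 1}) ∧
    (∀ F : Finset (Fin 4), F.card = 3 → ({v 2, v 3} : Finset (Fin 4)) ⊆ F →
        IsTopEdge r F {v 2, v 3}) ∧
    (∃ F G : Finset (Fin 4), F.card = 3 ∧ G.card = 3 ∧ F ≠ G ∧
        ({v 1, v 2} : Finset (Fin 4)) ⊆ F ∧ ({v 1, v 2} : Finset (Fin 4)) ⊆ G ∧
        (∀ H : Finset (Fin 4), H.card = 3 → ({v 1, v 2} : Finset (Fin 4)) ⊆ H →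
          H = F ∨ H = G) ∧
        IsBottomEdge r F {v 1, v 2} ∧ IsTopEdge r G {v 1, v 2}) ∧
    (∀ e : Finset (Fin 4),
        IsCompatiblyShortEdge r e ↔ (e = {v 0, v 1} ∨ e = {v 2, v 3})) := by
  have hinj : Function.Injective v := fun i j hij => by
    have hlt := hv i j
    have hgt := hv j i
    have hself := hv j j
    rw [hij] at hlt hgt
    have := hself.not.2 (lt_irrefl j)
    exact le_antisymm (not_lt.1 (hgt.not.1 this)) (not_lt.1 (hlt.not.1 this))
  obtain ⟨w, rfl⟩ : ∃ w : Fin 4 ≃ Fin 4, ⇑w = v :=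
    ⟨Equiv.ofBijective v (Finite.injective_iff_bijective.1 hinj), rfl⟩
  have hpair (i j : Fin 4) :
      ({w i, w j} : Finset (Fin 4)) = ({i, j} : Finset (Fin 4)).map w.toEmbedding := by simp
  simp only [hpair]
  rw [forall_face_map_iff, forall_face_map_iff]
  simp only [isBottomEdge_map_iff w hv, isTopEdge_map_iff w hv]
  refine ⟨isBottomEdge_lt_zero_one, isTopEdge_lt_two_three,
    ⟨({1, 2, 3} : Finset (Fin 4)).map w.toEmbedding,
      ({0, 1, 2} : Finset (Fin 4)).map w.toEmbedding, ?_⟩, ?_⟩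
  · rw [forall_face_map_iff]
    simp only [isBottomEdge_map_iff w hv, isTopEdge_map_iff w hv, Finset.card_map, ne_eq,
      Finset.map_inj, Finset.map_subset_map]
    exact ⟨rfl, rfl, by decide, by decide, by decide, eq_or_eq_of_one_two_subset,
      by decide, by decide⟩
  · rw [w.finsetCongr.surjective.forall]
    simp only [Equiv.finsetCongr_apply, isCompatiblyShortEdge_map_iff w hv, Finset.map_inj]
    exact isCompatiblyShortEdge_lt_iff
end
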